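/- Let T > 0, ξ ∈ C¹([0,T]), F ∈ C¹(ℝ) non-decreasing, and let H₁, H₂ ∈ C²(ℝ) be convex with H := H₁ − H₂ satisfying H(0) = 0 and H ≥ α·H₁ for some α ∈ (0,1]. Let u be a classical solution of du = ∂_x(F(∂_x u)) dt + H(∂_x u) dξ on 𝕋 × [0,T]. Then there exists a constant C > 0 depending only on α such that ∫_𝕋 H₁(∂_x u(x,T)) dx ≤ C · osc(u(·,0)) / D(0,T), where D(0,T) := max_{t ∈ [0,T]} (ξ(t) − min_{[0,t]} ξ), provided D(0,T) > 0. If moreover H₁ is even, then ∫_𝕋 H₁(∂_x u(x,T)) dx ≤ C · osc(u(·,0)) / osc_{0,T}(ξ), provided osc_{0,T}(ξ) > 0. -/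

import Mathlib

open Set MeasureTheory intervalIntegral

/-- A classical solution of `du = ∂ₓ(F(∂ₓu)) dt + H(∂ₓu) dξ` on `𝕋 × I`, where
`𝕋 = ℝ/ℤ` is realized as `1`-periodic functions of `x ∈ ℝ`: a function `u`,
`C²` in `x` and `C¹` in `t` (on `I`) with `∂ₜ∂ₓu` continuous, with space derivatives
`ux`, `uxx`, time derivative `ut` and mixed derivative `utx`, satisfying
`∂ₜu = ∂ₓ(F(∂ₓu)) + H(∂ₓu)·ξ'(t)` pointwise. -/
structure IsClassicalSolution (I : Set ℝ) (ξ F H : ℝ → ℝ)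
    (u ux uxx ut utx : ℝ → ℝ → ℝ) : Prop where
  periodic : ∀ x t, u (x + 1) t = u x t
  deriv_x : ∀ x : ℝ, ∀ t ∈ I, HasDerivAt (fun y => u y t) (ux x t) x
  deriv_xx : ∀ x : ℝ, ∀ t ∈ I, HasDerivAt (fun y => ux y t) (uxx x t) x
  deriv_t : ∀ x : ℝ, ∀ t ∈ I, HasDerivWithinAt (fun s => u x s) (ut x t) I t
  deriv_tx : ∀ x : ℝ, ∀ t ∈ I, HasDerivWithinAt (fun s => ux x s) (utx x t) I t
  cont_u : ContinuousOn (fun p : ℝ × ℝ => u p.1 p.2) (Set.univ ×ˢ I)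
  cont_ux : ContinuousOn (fun p : ℝ × ℝ => ux p.1 p.2) (Set.univ ×ˢ I)
  cont_uxx : ContinuousOn (fun p : ℝ × ℝ => uxx p.1 p.2) (Set.univ ×ˢ I)
  cont_ut : ContinuousOn (fun p : ℝ × ℝ => ut p.1 p.2) (Set.univ ×ˢ I)
  cont_utx : ContinuousOn (fun p : ℝ × ℝ => utx p.1 p.2) (Set.univ ×ˢ I)
  pde : ∀ x : ℝ, ∀ t ∈ I,
    ut x t = deriv (fun y => F (ux y t)) x + H (ux x t) * deriv ξ t

/-- The oscillation `osc_{s,t}(ξ) = max_{[s,t]} ξ - min_{[s,t]} ξ` of a (continuous)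
function `ξ` on the interval `[s, t]`. -/
noncomputable def oscOn (ξ : ℝ → ℝ) (s t : ℝ) : ℝ :=
  sSup (ξ '' Set.Icc s t) - sInf (ξ '' Set.Icc s t)

/-- The maximal "drawup" of `ξ` on `[s,t]`:
`D(s,t) := max_{r ∈ [s,t]} (ξ r - min_{[s,r]} ξ)`. -/
noncomputable def drawup (ξ : ℝ → ℝ) (s t : ℝ) : ℝ :=
  sSup ((fun r => ξ r - sInf (ξ '' Set.Icc s r)) '' Set.Icc s t)

/-- A Stieltjes-type estimate: if `U' = (A - B) ξ'` with `A`, `B` non-increasing and `ξ` stays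
between its values at the endpoints of `[s, t]`, then
`(A t - B s) * (ξ t - ξ s) ≤ U t - U s`. -/
lemma sub_mul_sub_le_of_hasDerivAt {s t : ℝ} (hst : s ≤ t) {U A B ξ A' B' ξ' : ℝ → ℝ}
    (hU : ContinuousOn U (Icc s t)) (hA : ContinuousOn A (Icc s t))
    (hB : ContinuousOn B (Icc s t)) (hξ : ContinuousOn ξ (Icc s t))
    (hA' : ∀ r ∈ Ioo s t, HasDerivAt A (A' r) r) (hB' : ∀ r ∈ Ioo s t, HasDerivAt B (B' r) r)
    (hξ' : ∀ r ∈ Ioo s t, HasDerivAt ξ (ξ' r) r)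
    (hU' : ∀ r ∈ Ioo s t, HasDerivAt U ((A r - B r) * ξ' r) r)
    (hA0 : ∀ r ∈ Ioo s t, A' r ≤ 0) (hB0 : ∀ r ∈ Ioo s t, B' r ≤ 0)
    (hmin : ∀ r ∈ Icc s t, ξ s ≤ ξ r) (hmax : ∀ r ∈ Icc s t, ξ r ≤ ξ t) :
    (A t - B s) * (ξ t - ξ s) ≤ U t - U s := by
  have hmono : MonotoneOn (fun r => U r - A r * (ξ r - ξ s) - B r * (ξ t - ξ r)) (Icc s t) := by
    refine monotoneOn_of_hasDerivWithinAt_nonneg (convex_Icc s t)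
      (f' := fun r => -A' r * (ξ r - ξ s) + -B' r * (ξ t - ξ r)) (by fun_prop) ?_ ?_
    · intro r hr
      rw [interior_Icc] at hr
      have h := ((hU' r hr).sub ((hA' r hr).mul ((hξ' r hr).sub_const (ξ s)))).sub
        ((hB' r hr).mul ((hξ' r hr).const_sub (ξ t)))
      exact (h.congr_deriv (by simp; ring)).hasDerivWithinAt
    · intro r hr
      rw [interior_Icc] at hr
      have hr' := Ioo_subset_Icc_self hr
      have h1 := mul_nonneg (neg_nonneg.2 (hA0 r hr)) (sub_nonneg.2 (hmin r hr'))
      have h2 := mul_nonneg (neg_nonneg.2 (hB0 r hr)) (sub_nonneg.2 (hmax r hr'))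
      linarith
  have h := hmono (left_mem_Icc.2 hst) (right_mem_Icc.2 hst) hst
  simp only [sub_self, mul_zero, sub_zero] at h
  linarith

/-- If `ξ a ≤ m ≤ ξ b`, the last time before `b` at which `ξ` takes the value `m`. -/
lemma exists_last_eq {a b m : ℝ} (hab : a ≤ b) {ξ : ℝ → ℝ} (hξ : ContinuousOn ξ (Icc a b))
    (ham : ξ a ≤ m) (hmb : m ≤ ξ b) :
    ∃ s ∈ Icc a b, ξ s = m ∧ ∀ r ∈ Icc s b, m ≤ ξ r := by
  have hcomp : IsCompact (Icc a b ∩ ξ ⁻¹' {m}) :=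
    isCompact_Icc.of_isClosed_subset (hξ.preimage_isClosed_of_isClosed isClosed_Icc
      isClosed_singleton) inter_subset_left
  obtain ⟨s, ⟨hs, hsm⟩, hgreatest⟩ := hcomp.exists_isGreatest
    (intermediate_value_Icc hab hξ ⟨ham, hmb⟩)
  refine ⟨s, hs, hsm, fun r hr => ?_⟩
  by_contra! hlt
  obtain ⟨z, hz, hzm⟩ := intermediate_value_Icc hr.2
    (hξ.mono (Icc_subset_Icc_left (hs.1.trans hr.1))) ⟨hlt.le, hmb⟩
  have hzs := hgreatest ⟨⟨hs.1.trans (hr.1.trans hz.1), hz.2⟩, hzm⟩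
  have hrs : r = s := le_antisymm (hz.1.trans hzs) hr.1
  exact hlt.ne (hrs ▸ hsm)

/-- The constant of the decay estimate. -/
noncomputable def decayConst (α : ℝ) : ℝ :=
  1 / ((α / 2) * (1 - (1 - α) / (1 - α / 2)))

lemma decayConst_pos {α : ℝ} (hα : α ∈ Ioc (0 : ℝ) 1) : 0 < decayConst α := by
  obtain ⟨h0, h1⟩ := hα
  have : (1 - α) / (1 - α / 2) < 1 := by
    rw [div_lt_one (by linarith)]; linarith
  exact one_div_pos.2 (mul_pos (by linarith) (by linarith))

lemma decayConst_eq {α : ℝ} (hα : α ∈ Ioc (0 : ℝ) 1) :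
    (1 - α) * (decayConst α / (1 - α / 2)) + 2 / α = decayConst α := by
  obtain ⟨h0, h1⟩ := hα
  have h2 : (2 : ℝ) - α ≠ 0 := by linarith
  have h3 : 1 - (1 - α) / (1 - α / 2) = α / (2 - α) := by
    field_simp; ring
  have h4 : (1 - α / 2) = (2 - α) / 2 := by ring
  rw [decayConst, h3, h4]
  field_simp
  ring

/-- Iterated decay along a ladder of levels of `ξ`. -/
lemma le_pow_mul_add_of_step {α K a T : ℝ} (hα : α ∈ Ioc (0 : ℝ) 1) (hK : 0 ≤ K)
    {A ξ : ℝ → ℝ} (hA : AntitoneOn A (Icc a T)) (hξ : ContinuousOn ξ (Icc a T))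
    (hstep : ∀ s ∈ Icc a T, ∀ t ∈ Icc a T, s ≤ t → (∀ r ∈ Icc s t, ξ s ≤ ξ r) →
      (∀ r ∈ Icc s t, ξ r ≤ ξ t) → A t * (ξ t - ξ s) ≤ (1 - α) * A s * (ξ t - ξ s) + K)
    (n : ℕ) : ∀ c ∈ Icc a T, ξ a < ξ c →
      A c ≤ (1 - α) ^ n * A a + K * decayConst α / (ξ c - ξ a) := by
  have hC := decayConst_pos hα
  have hα' := hα
  obtain ⟨h0, h1⟩ := hα'
  induction n with
  | zero =>
    intro c hc hac
    have := hA (left_mem_Icc.2 (hc.1.trans hc.2)) hc hc.1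
    have h2 : 0 ≤ K * decayConst α / (ξ c - ξ a) :=
      div_nonneg (mul_nonneg hK hC.le) (by linarith)
    simp only [pow_zero, one_mul]
    linarith
  | succ n ih =>
    intro c hc hac
    obtain ⟨c₁, hc₁, hmax⟩ := isCompact_Icc.exists_isMaxOn (nonempty_Icc.2 hc.1)
      (hξ.mono (Icc_subset_Icc_right hc.2))
    have hcc₁ : ξ c ≤ ξ c₁ := hmax (right_mem_Icc.2 hc.1)
    have hc₁' : c₁ ∈ Icc a T := ⟨hc₁.1, hc₁.2.trans hc.2⟩
    set h := ξ c₁ - ξ a with hh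
    have hpos : 0 < h := by linarith
    obtain ⟨s, hs, hsm, hsr⟩ := exists_last_eq (m := ξ a + (1 - α / 2) * h) hc₁.1
      (hξ.mono (Icc_subset_Icc_right hc₁'.2))
      (by nlinarith) (by nlinarith)
    have hs' : s ∈ Icc a T := ⟨hs.1, hs.2.trans hc₁'.2⟩
    have hsa : ξ s - ξ a = (1 - α / 2) * h := by linarith
    have hst : ξ c₁ - ξ s = α / 2 * h := by linarith
    have hqpos : 0 < (1 - α / 2) * h := mul_pos (by linarith) hpos
    have e1 := hstep s hs' c₁ hc₁' hs.2 (fun r hr => hsm ▸ hsr r hr)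
      (fun r hr => hmax ⟨hs.1.trans hr.1, hr.2.trans hc₁.2⟩)
    rw [hst] at e1
    have hd : 0 < α / 2 * h := by positivity
    have e2 : A c₁ ≤ (1 - α) * A s + K / (α / 2 * h) := by
      rw [← sub_le_iff_le_add', le_div_iff₀ hd]; linarith
    have e3 := mul_le_mul_of_nonneg_left (ih s hs' (by linarith)) (sub_nonneg.2 h1)
    rw [hsa] at e3
    have e4 : A c ≤ A c₁ := hA hc₁' hc hc₁.2
    have e5 : K * decayConst α / h ≤ K * decayConst α / (ξ c - ξ a) :=
      div_le_div_of_nonneg_left (mul_nonneg hK hC.le) (by linarith) (by linarith)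
    have e6 : (1 - α) * (K * decayConst α / ((1 - α / 2) * h)) + K / (α / 2 * h)
        = K * decayConst α / h := by
      have hq : (1 - α / 2) ≠ 0 := by linarith
      conv_rhs => rw [← decayConst_eq hα]
      generalize decayConst α = C
      generalize 1 - α / 2 = q at hq
      field_simp
    have e7 : (1 - α) ^ (n + 1) * A a = (1 - α) * ((1 - α) ^ n * A a) := by ring
    rw [e7]
    linarith

lemma mul_sub_le_of_step {α K a T : ℝ} (hα : α ∈ Ioc (0 : ℝ) 1) (hK : 0 ≤ K)
    {A ξ : ℝ → ℝ} (hA : AntitoneOn A (Icc a T)) (hξ : ContinuousOn ξ (Icc a T))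
    (hstep : ∀ s ∈ Icc a T, ∀ t ∈ Icc a T, s ≤ t → (∀ r ∈ Icc s t, ξ s ≤ ξ r) →
      (∀ r ∈ Icc s t, ξ r ≤ ξ t) → A t * (ξ t - ξ s) ≤ (1 - α) * A s * (ξ t - ξ s) + K)
    {c : ℝ} (hc : c ∈ Icc a T) (hac : ξ a < ξ c) :
    A T * (ξ c - ξ a) ≤ decayConst α * K := by
  have hlim : Filter.Tendsto (fun n : ℕ => (1 - α) ^ n * A a + K * decayConst α / (ξ c - ξ a))
      Filter.atTop (nhds (0 * A a + K * decayConst α / (ξ c - ξ a))) :=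
    ((tendsto_pow_atTop_nhds_zero_of_lt_one (by linarith [hα.2]) (by linarith [hα.1])).mul_const
      _).add_const _
  have h1 := ge_of_tendsto' hlim
    (fun n => le_pow_mul_add_of_step hα hK hA hξ hstep n c hc hac)
  have h2 := hA hc (right_mem_Icc.2 (hc.1.trans hc.2)) hc.2
  rw [zero_mul, zero_add] at h1
  have := (le_div_iff₀ (sub_pos.2 hac)).1 (h2.trans h1)
  linarith

/-- A one-sided second derivative test at a maximum. -/
lemma second_deriv_nonpos_of_isMax {f f' : ℝ → ℝ} {x c : ℝ} (hf : ∀ y, HasDerivAt f (f' y) y)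
    (hf' : HasDerivAt f' c x) (hmax : ∀ y, f y ≤ f x) : f' x = 0 ∧ c ≤ 0 := by
  have h0 : f' x = 0 :=
    IsLocalMax.hasDerivAt_eq_zero (Filter.Eventually.of_forall hmax) (hf x)
  refine ⟨h0, ?_⟩
  by_contra! hc
  have hev := eventually_nhdsWithin_sign_eq_of_deriv_pos (by rwa [hf'.deriv]) h0
  have hpos : ∀ᶠ y in nhdsWithin x (Ioi x), 0 < f' y := by
    filter_upwards [nhdsWithin_le_nhds hev, self_mem_nhdsWithin] with y hy hxy
    rw [sign_pos (sub_pos.2 hxy)] at hy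
    exact sign_eq_one_iff.1 hy
  obtain ⟨b, hxb, hb⟩ := mem_nhdsGT_iff_exists_Ioo_subset.1 hpos
  obtain ⟨y, hy, hyeq⟩ := exists_hasDerivAt_eq_slope f f'
    (show x < (x + b) / 2 by linarith [mem_Ioi.1 hxb])
    (fun z _ => (hf z).continuousAt.continuousWithinAt) (fun z _ => hf z)
  have hy' : 0 < f' y := hb ⟨hy.1, by linarith [hy.2, mem_Ioi.1 hxb]⟩
  rw [hyeq] at hy'
  have hd : 0 < (x + b) / 2 - x := by linarith [mem_Ioi.1 hxb]
  have := (div_pos_iff_of_pos_right hd).1 hy'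
  linarith [hmax ((x + b) / 2)]

/-- Parabolic maximum principle for space-periodic functions. -/
lemma le_of_periodic_of_maximum_principle {T M : ℝ} {w wx wxx wt : ℝ → ℝ → ℝ}
    (hper : ∀ x t, w (x + 1) t = w x t)
    (hx : ∀ x : ℝ, ∀ t ∈ Icc 0 T, HasDerivAt (fun y => w y t) (wx x t) x)
    (hxx : ∀ x : ℝ, ∀ t ∈ Icc 0 T, HasDerivAt (fun y => wx y t) (wxx x t) x)
    (ht : ∀ x : ℝ, ∀ t ∈ Icc 0 T, HasDerivWithinAt (fun s => w x s) (wt x t) (Icc 0 T) t)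
    (hcont : ContinuousOn (fun p : ℝ × ℝ => w p.1 p.2) (Set.univ ×ˢ Icc 0 T))
    (hsub : ∀ x : ℝ, ∀ t ∈ Icc 0 T, wx x t = 0 → wxx x t ≤ 0 → wt x t ≤ 0)
    (h0 : ∀ x, w x 0 ≤ M) {x t : ℝ} (htT : t ∈ Icc 0 T) : w x t ≤ M := by
  have key : ∀ ε > 0, w x t ≤ M + ε * t := by
    intro ε hε
    obtain ⟨⟨x₀, t₀⟩, ⟨-, ht₀⟩, hmax⟩ :=
      (isCompact_Icc.prod isCompact_Icc : IsCompact (Icc (0 : ℝ) 1 ×ˢ Icc (0 : ℝ) T)).exists_isMaxOn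
        ⟨(0, t), ⟨⟨le_rfl, zero_le_one⟩, htT⟩⟩
        (f := fun p : ℝ × ℝ => w p.1 p.2 - ε * p.2)
        ((hcont.mono (prod_mono (subset_univ _) le_rfl)).sub (by fun_prop))
    change t₀ ∈ Icc 0 T at ht₀
    have hglob : ∀ y, ∀ s ∈ Icc 0 T, w y s - ε * s ≤ w x₀ t₀ - ε * t₀ := by
      intro y s hs
      have hp : Function.Periodic (fun z => w z s) 1 := fun z => hper z s
      obtain ⟨z, hz, hzy⟩ := hp.exists_mem_Ico₀ one_pos y
      rw [hzy]
      exact hmax (show (z, s) ∈ Icc (0 : ℝ) 1 ×ˢ Icc (0 : ℝ) T from ⟨Ico_subset_Icc_self hz, hs⟩)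
    have h1 := hglob x t htT
    rcases ht₀.1.eq_or_lt with h | hpos
    · rw [← h] at h1
      linarith [h0 x₀]
    · exfalso
      obtain ⟨e1, e2⟩ := second_deriv_nonpos_of_isMax (fun y => hx y t₀ ht₀) (hxx x₀ t₀ ht₀)
        (fun y => by linarith [hglob y t₀ ht₀])
      have e3 := hsub x₀ t₀ ht₀ e1 e2
      have hd : HasDerivWithinAt (fun s => w x₀ s - ε * s) (wt x₀ t₀ - ε * 1) (Icc 0 T) t₀ :=
        (ht x₀ t₀ ht₀).sub ((hasDerivWithinAt_id t₀ _).const_mul ε)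
      have hloc : IsLocalMaxOn (fun s => w x₀ s - ε * s) (Icc 0 T) t₀ :=
        IsMaxOn.localize (fun s hs => hglob x₀ s hs)
      have := hloc.hasFDerivWithinAt_nonpos hd.hasFDerivWithinAt
        (y := 0 - t₀) (sub_mem_posTangentConeAt_of_segment_subset
          ((convex_Icc 0 T).segment_subset ht₀ ⟨le_rfl, ht₀.1.trans ht₀.2⟩))
      simp at this
      nlinarith
  refine le_of_forall_pos_le_add fun ε hε => ?_
  have h := key (ε / (t + 1)) (div_pos hε (by linarith [htT.1]))
  have : ε / (t + 1) * t ≤ ε := by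
    rw [div_mul_eq_mul_div, div_le_iff₀ (by linarith [htT.1])]; nlinarith
  linarith

/-- Slices in time of a function continuous on a strip. -/
lemma ContinuousOn.continuous_slice {T t : ℝ} (ht : t ∈ Icc 0 T) {g : ℝ → ℝ → ℝ}
    (hg : ContinuousOn (fun p : ℝ × ℝ => g p.1 p.2) (Set.univ ×ˢ Icc 0 T)) :
    Continuous fun x => g x t :=
  hg.comp_continuous (f := fun x : ℝ => (x, t)) (by fun_prop) fun _ => ⟨mem_univ _, ht⟩

lemma continuousOn_integral_strip {T : ℝ} (hT : 0 ≤ T) {g : ℝ → ℝ → ℝ}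
    (hg : ContinuousOn (fun p : ℝ × ℝ => g p.1 p.2) (Set.univ ×ˢ Icc 0 T)) (a b : ℝ) :
    ContinuousOn (fun t => ∫ x in a..b, g x t) (Icc 0 T) := by
  have hc : Continuous (Function.uncurry fun t x => g x (projIcc 0 T hT t)) :=
    hg.comp_continuous (f := fun p : ℝ × ℝ => (p.2, (projIcc 0 T hT p.1 : ℝ)))
      (by fun_prop) fun p => ⟨mem_univ _, (projIcc 0 T hT p.1).2⟩
  refine (continuous_parametric_intervalIntegral_of_continuous' (μ := volume) hc a b
    ).continuousOn.congr fun t ht => ?_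
  simp only [projIcc_of_mem hT ht]

/-- Differentiation under the integral sign on a strip. -/
lemma hasDerivAt_integral_strip {T t : ℝ} (ht : t ∈ Ioo 0 T) {g g' : ℝ → ℝ → ℝ}
    (hg : ContinuousOn (fun p : ℝ × ℝ => g p.1 p.2) (Set.univ ×ˢ Icc 0 T))
    (hg' : ContinuousOn (fun p : ℝ × ℝ => g' p.1 p.2) (Set.univ ×ˢ Icc 0 T))
    (hd : ∀ x, ∀ s ∈ Icc 0 T, HasDerivWithinAt (fun s => g x s) (g' x s) (Icc 0 T) s) (a b : ℝ) :
    HasDerivAt (fun t => ∫ x in a..b, g x t) (∫ x in a..b, g' x t) t := by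
  obtain ⟨K, hK⟩ := (isCompact_uIcc.prod isCompact_Icc :
    IsCompact (uIcc a b ×ˢ Icc (0 : ℝ) T)).exists_bound_of_continuousOn
      (hg'.mono (prod_mono (subset_univ _) le_rfl))
  have ht' := Ioo_subset_Icc_self ht
  refine (hasDerivAt_integral_of_dominated_loc_of_deriv_le (μ := volume)
    (F := fun t x => g x t) (F' := fun t x => g' x t) (bound := fun _ => K)
    (isOpen_Ioo.mem_nhds ht) ?_ ((hg.continuous_slice ht').intervalIntegrable _ _)
    (hg'.continuous_slice ht').aestronglyMeasurable ?_ intervalIntegrable_const ?_).2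
  · filter_upwards [isOpen_Ioo.mem_nhds ht] with s hs
    exact (hg.continuous_slice (Ioo_subset_Icc_self hs)).aestronglyMeasurable
  · exact Filter.Eventually.of_forall fun x hx s hs =>
      hK (x, s) ⟨uIoc_subset_uIcc hx, Ioo_subset_Icc_self hs⟩
  · exact Filter.Eventually.of_forall fun x _ s hs =>
      (hd x s (Ioo_subset_Icc_self hs)).hasDerivAt (Icc_mem_nhds hs.1 hs.2)

namespace IsClassicalSolution

variable {T : ℝ} {ξ F H : ℝ → ℝ} {u ux uxx ut utx : ℝ → ℝ → ℝ}

lemma ux_periodic (h : IsClassicalSolution (Icc 0 T) ξ F H u ux uxx ut utx)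
    {t : ℝ} (ht : t ∈ Icc 0 T) (x : ℝ) : ux (x + 1) t = ux x t := by
  have h1 := (h.deriv_x (x + 1) t ht).comp_add_const x 1
  simp only [h.periodic] at h1
  exact h1.unique (h.deriv_x x t ht)

lemma ut_periodic (h : IsClassicalSolution (Icc 0 T) ξ F H u ux uxx ut utx)
    {t : ℝ} (ht : t ∈ Ioo 0 T) (x : ℝ) : ut (x + 1) t = ut x t := by
  have hn : Icc 0 T ∈ nhds t := Icc_mem_nhds ht.1 ht.2
  have h1 := (h.deriv_t (x + 1) t (Ioo_subset_Icc_self ht)).hasDerivAt hn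
  simp only [h.periodic] at h1
  exact h1.unique ((h.deriv_t x t (Ioo_subset_Icc_self ht)).hasDerivAt hn)

/-- Equality of the mixed derivatives. -/
lemma hasDerivAt_ut (h : IsClassicalSolution (Icc 0 T) ξ F H u ux uxx ut utx)
    {t : ℝ} (ht : t ∈ Ioo 0 T) (x : ℝ) : HasDerivAt (fun y => ut y t) (utx x t) x := by
  have hn : Icc 0 T ∈ nhds t := Icc_mem_nhds ht.1 ht.2
  have ht' := Ioo_subset_Icc_self ht
  have hcont := h.cont_utx.continuous_slice ht'
  have hprim : ∀ y, ut y t = ut 0 t + ∫ z in (0 : ℝ)..y, utx z t := by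
    intro y
    have h1 := hasDerivAt_integral_strip ht h.cont_ux h.cont_utx h.deriv_tx 0 y
    have h2 : HasDerivAt (fun s => u y s - u 0 s) (ut y t - ut 0 t) t :=
      ((h.deriv_t y t ht').hasDerivAt hn).sub ((h.deriv_t 0 t ht').hasDerivAt hn)
    have h3 : (fun s => ∫ z in (0 : ℝ)..y, ux z s) =ᶠ[nhds t] fun s => u y s - u 0 s := by
      filter_upwards [hn] with s hs
      exact integral_eq_sub_of_hasDerivAt (fun z _ => h.deriv_x z s hs)
        ((h.cont_ux.continuous_slice hs).intervalIntegrable _ _)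
    have := (h1.congr_of_eventuallyEq h3.symm).unique h2
    linarith
  rw [funext hprim]
  exact (hcont.integral_hasStrictDerivAt 0 x).hasDerivAt.const_add _

lemma ut_eq (h : IsClassicalSolution (Icc 0 T) ξ F H u ux uxx ut utx) (hF : ContDiff ℝ 1 F)
    {t : ℝ} (ht : t ∈ Icc 0 T) (x : ℝ) :
    ut x t = deriv F (ux x t) * uxx x t + H (ux x t) * deriv ξ t := by
  have hd : HasDerivAt (fun y => F (ux y t)) (deriv F (ux x t) * uxx x t) x :=
    HasDerivAt.comp x (hF.differentiable one_ne_zero _).hasDerivAt (h.deriv_xx x t ht)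
  rw [h.pde x t ht, hd.deriv]

/-- The integral of `g(∂ₓu) ∂ₓₓu` over a period vanishes. -/
lemma integral_deriv_comp_eq_zero (h : IsClassicalSolution (Icc 0 T) ξ F H u ux uxx ut utx)
    {t : ℝ} (ht : t ∈ Icc 0 T) {G : ℝ → ℝ} {g : ℝ → ℝ} (hG : ∀ p, HasDerivAt G (g p) p)
    (hg : Continuous g) : ∫ x in (0 : ℝ)..1, g (ux x t) * uxx x t = 0 := by
  rw [integral_eq_sub_of_hasDerivAt (f := fun x => G (ux x t))
    (fun x _ => HasDerivAt.comp x (hG _) (h.deriv_xx x t ht))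
    (((hg.comp (h.cont_ux.continuous_slice ht)).mul
      (h.cont_uxx.continuous_slice ht)).intervalIntegrable _ _)]
  have := h.ux_periodic ht 0
  rw [zero_add] at this
  rw [this, sub_self]

lemma hasDerivAt_integral_u (h : IsClassicalSolution (Icc 0 T) ξ F H u ux uxx ut utx)
    (hF : ContDiff ℝ 1 F) (hH : Continuous H) {t : ℝ} (ht : t ∈ Ioo 0 T) :
    HasDerivAt (fun s => ∫ x in (0 : ℝ)..1, u x s)
      ((∫ x in (0 : ℝ)..1, H (ux x t)) * deriv ξ t) t := by
  have ht' := Ioo_subset_Icc_self ht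
  have hc := h.cont_ux.continuous_slice ht'
  have hc' := h.cont_uxx.continuous_slice ht'
  have hF' : Continuous (deriv F) := hF.continuous_deriv_one
  refine (hasDerivAt_integral_strip ht h.cont_u h.cont_ut h.deriv_t 0 1).congr_deriv ?_
  simp only [h.ut_eq hF ht']
  rw [integral_add (Continuous.intervalIntegrable (by fun_prop) _ _)
    (Continuous.intervalIntegrable (by fun_prop) _ _), h.integral_deriv_comp_eq_zero ht'
      (fun p => (hF.differentiable one_ne_zero p).hasDerivAt) hF', zero_add,
    intervalIntegral.integral_mul_const]

/-- Entropy dissipation: `∫ η(∂ₓu)` is non-increasing for convex `η`. -/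
lemma exists_hasDerivAt_entropy (h : IsClassicalSolution (Icc 0 T) ξ F H u ux uxx ut utx)
    (hF : ContDiff ℝ 1 F) (hFm : Monotone F) (hH : Continuous H) {η : ℝ → ℝ}
    (hη : ContDiff ℝ 2 η) (hconv : ConvexOn ℝ Set.univ η) {t : ℝ} (ht : t ∈ Ioo 0 T) :
    ∃ d ≤ 0, HasDerivAt (fun s => ∫ x in (0 : ℝ)..1, η (ux x s)) d t := by
  have ht' := Ioo_subset_Icc_self ht
  have hc := h.cont_ux.continuous_slice ht'
  have hc' := h.cont_uxx.continuous_slice ht'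
  have hct := h.cont_utx.continuous_slice ht'
  have hF' : Continuous (deriv F) := hF.continuous_deriv_one
  have hdη : Differentiable ℝ η := hη.differentiable two_ne_zero
  have hη1 : ContDiff ℝ 1 (deriv η) := ContDiff.deriv' (by rwa [one_add_one_eq_two])
  have hdη1 : Differentiable ℝ (deriv η) := hη1.differentiable one_ne_zero
  have hη2 : Continuous (deriv (deriv η)) := hη1.continuous_deriv_one
  have hη2nonneg : ∀ p, 0 ≤ deriv (deriv η) p := fun p =>
    (monotoneOn_univ.1 (hconv.monotoneOn_deriv fun x _ => hdη x)).deriv_nonneg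
  have hd := hasDerivAt_integral_strip ht (g := fun x s => η (ux x s))
    (g' := fun x s => deriv η (ux x s) * utx x s)
    (hη.continuous.comp_continuousOn h.cont_ux)
    ((hη1.continuous.comp_continuousOn h.cont_ux).mul h.cont_utx)
    (fun x s hs => (hdη _).hasDerivAt.comp_hasDerivWithinAt s (h.deriv_tx x s hs)) 0 1
  refine ⟨_, ?_, hd⟩
  have hparts := integral_mul_deriv_eq_deriv_mul (a := 0) (b := 1)
    (u := fun x => deriv η (ux x t)) (u' := fun x => deriv (deriv η) (ux x t) * uxx x t)
    (v := fun x => ut x t) (v' := fun x => utx x t)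
    (fun x _ => HasDerivAt.comp x (hdη1 _).hasDerivAt (h.deriv_xx x t ht'))
    (fun x _ => h.hasDerivAt_ut ht x)
    (Continuous.intervalIntegrable (by fun_prop) _ _)
    (Continuous.intervalIntegrable (by fun_prop) _ _)
  have hp1 := h.ux_periodic ht' 0
  have hp2 := h.ut_periodic ht 0
  rw [zero_add] at hp1 hp2
  rw [hparts, hp1, hp2, sub_self, zero_sub, neg_nonpos]
  have hsplit : ∀ x, deriv (deriv η) (ux x t) * uxx x t * ut x t
      = deriv (deriv η) (ux x t) * deriv F (ux x t) * uxx x t ^ 2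
        + deriv ξ t * (deriv (deriv η) (ux x t) * H (ux x t) * uxx x t) := by
    intro x
    rw [h.ut_eq hF ht']
    ring
  have hzero : ∫ x in (0 : ℝ)..1, deriv (deriv η) (ux x t) * H (ux x t) * uxx x t = 0 :=
    h.integral_deriv_comp_eq_zero ht' (g := fun p => deriv (deriv η) p * H p)
      (fun p => ((hη2.mul hH).integral_hasStrictDerivAt 0 p).hasDerivAt) (hη2.mul hH)
  simp only [hsplit]
  rw [integral_add (Continuous.intervalIntegrable (by fun_prop) _ _)
    (Continuous.intervalIntegrable (by fun_prop) _ _), intervalIntegral.integral_const_mul,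
    hzero, mul_zero, add_zero]
  exact integral_nonneg zero_le_one fun x _ =>
    mul_nonneg (mul_nonneg (hη2nonneg _) hFm.deriv_nonneg) (sq_nonneg _)

lemma le_of_initial_le (h : IsClassicalSolution (Icc 0 T) ξ F H u ux uxx ut utx)
    (hF : ContDiff ℝ 1 F) (hFm : Monotone F) (hH0 : H 0 = 0) {M : ℝ} (hM : ∀ x, u x 0 ≤ M)
    {t : ℝ} (ht : t ∈ Icc 0 T) (x : ℝ) : u x t ≤ M := by
  refine le_of_periodic_of_maximum_principle h.periodic h.deriv_x h.deriv_xx h.deriv_t h.cont_u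
    (fun x t ht h1 h2 => ?_) hM ht
  rw [h.ut_eq hF ht, h1, hH0, zero_mul, add_zero]
  exact mul_nonpos_of_nonneg_of_nonpos hFm.deriv_nonneg h2

lemma le_of_le_initial (h : IsClassicalSolution (Icc 0 T) ξ F H u ux uxx ut utx)
    (hF : ContDiff ℝ 1 F) (hFm : Monotone F) (hH0 : H 0 = 0) {m : ℝ} (hm : ∀ x, m ≤ u x 0)
    {t : ℝ} (ht : t ∈ Icc 0 T) (x : ℝ) : m ≤ u x t := by
  refine neg_le_neg_iff.1 (le_of_periodic_of_maximum_principle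
    (w := fun x t => -u x t) (wx := fun x t => -ux x t) (wxx := fun x t => -uxx x t)
    (wt := fun x t => -ut x t) (fun x t => by rw [h.periodic])
    (fun x t ht => (h.deriv_x x t ht).neg) (fun x t ht => (h.deriv_xx x t ht).neg)
    (fun x t ht => (h.deriv_t x t ht).neg) h.cont_u.neg
    (fun x t ht h1 h2 => ?_) (fun x => neg_le_neg (hm x)) ht)
  rw [h.ut_eq hF ht, neg_eq_zero.1 h1, hH0, zero_mul, add_zero]
  exact neg_nonpos.2 (mul_nonneg hFm.deriv_nonneg (neg_nonpos.1 h2))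

lemma abs_integral_sub_le_osc (h : IsClassicalSolution (Icc 0 T) ξ F H u ux uxx ut utx)
    (hF : ContDiff ℝ 1 F) (hFm : Monotone F) (hH0 : H 0 = 0)
    {s t : ℝ} (hs : s ∈ Icc 0 T) (ht : t ∈ Icc 0 T) :
    |(∫ x in (0 : ℝ)..1, u x t) - ∫ x in (0 : ℝ)..1, u x s| ≤ oscOn (fun x => u x 0) 0 1 := by
  have h0 : (0 : ℝ) ∈ Icc 0 T := ⟨le_rfl, hs.1.trans hs.2⟩
  have hcomp : IsCompact ((fun x => u x 0) '' Icc 0 1) :=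
    isCompact_Icc.image (h.cont_u.continuous_slice h0)
  have hper : Function.Periodic (fun x => u x 0) 1 := fun x => h.periodic x 0
  have hmem : ∀ x, u x 0 ∈ (fun x => u x 0) '' Icc 0 1 := fun x => by
    obtain ⟨y, hy, hxy⟩ := hper.exists_mem_Ico₀ one_pos x
    exact ⟨y, Ico_subset_Icc_self hy, hxy.symm⟩
  have hle : ∀ r ∈ Icc 0 T,
      (∫ x in (0 : ℝ)..1, u x r) ≤ sSup ((fun x => u x 0) '' Icc 0 1) := fun r hr => by
    have := integral_mono_on (μ := volume) zero_le_one
      ((h.cont_u.continuous_slice hr).intervalIntegrable 0 1) intervalIntegrable_const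
      (fun x _ => h.le_of_initial_le hF hFm hH0 (fun x => le_csSup hcomp.bddAbove (hmem x)) hr x)
    simpa using this
  have hge : ∀ r ∈ Icc 0 T,
      sInf ((fun x => u x 0) '' Icc 0 1) ≤ ∫ x in (0 : ℝ)..1, u x r := fun r hr => by
    have := integral_mono_on (μ := volume) zero_le_one intervalIntegrable_const
      ((h.cont_u.continuous_slice hr).intervalIntegrable 0 1)
      (fun x _ => h.le_of_le_initial hF hFm hH0 (fun x => csInf_le hcomp.bddBelow (hmem x)) hr x)
    simpa using this
  rw [oscOn, abs_le]
  constructor <;> linarith [hle s hs, hle t ht, hge s hs, hge t ht]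

/-- The decay estimate between any two times, for either sign of the increment of `ξ`. -/
lemma integral_mul_abs_sub_le {α : ℝ} (hα : α ∈ Ioc (0 : ℝ) 1) (hξ : ContDiff ℝ 1 ξ)
    (hF : ContDiff ℝ 1 F) (hFm : Monotone F) {H₁ H₂ : ℝ → ℝ} (hH₁ : ContDiff ℝ 2 H₁)
    (hH₂ : ContDiff ℝ 2 H₂) (hc₁ : ConvexOn ℝ Set.univ H₁) (hc₂ : ConvexOn ℝ Set.univ H₂)
    (hH0 : H₁ 0 - H₂ 0 = 0) (hαH : ∀ p : ℝ, α * H₁ p ≤ H₁ p - H₂ p)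
    (h : IsClassicalSolution (Icc 0 T) ξ F (fun p => H₁ p - H₂ p) u ux uxx ut utx)
    {a b : ℝ} (ha : a ∈ Icc 0 T) (hb : b ∈ Icc 0 T) (hab : a ≤ b) :
    (∫ x in (0 : ℝ)..1, H₁ (ux x T)) * |ξ b - ξ a|
      ≤ decayConst α * oscOn (fun x => u x 0) 0 1 := by
  have hT : 0 ≤ T := ha.1.trans ha.2
  have hHc : Continuous fun p => H₁ p - H₂ p := hH₁.continuous.sub hH₂.continuous
  have hK : 0 ≤ oscOn (fun x => u x 0) 0 1 :=
    (abs_nonneg _).trans (h.abs_integral_sub_le_osc hF hFm hH0 ha ha)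
  set A : ℝ → ℝ := fun t => ∫ x in (0 : ℝ)..1, H₁ (ux x t) with hA
  set B : ℝ → ℝ := fun t => ∫ x in (0 : ℝ)..1, H₂ (ux x t) with hB
  set U : ℝ → ℝ := fun t => ∫ x in (0 : ℝ)..1, u x t with hU
  have hAc : ContinuousOn A (Icc 0 T) :=
    continuousOn_integral_strip hT (hH₁.continuous.comp_continuousOn h.cont_ux) 0 1
  have hBc : ContinuousOn B (Icc 0 T) :=
    continuousOn_integral_strip hT (hH₂.continuous.comp_continuousOn h.cont_ux) 0 1
  have hUc : ContinuousOn U (Icc 0 T) := continuousOn_integral_strip hT h.cont_u 0 1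
  choose! A' hA0 hA' using fun t (ht : t ∈ Ioo 0 T) =>
    h.exists_hasDerivAt_entropy hF hFm hHc hH₁ hc₁ ht
  choose! B' hB0 hB' using fun t (ht : t ∈ Ioo 0 T) =>
    h.exists_hasDerivAt_entropy hF hFm hHc hH₂ hc₂ ht
  have hint : ∀ t ∈ Icc 0 T, IntervalIntegrable (fun x => H₁ (ux x t)) volume 0 1 ∧
      IntervalIntegrable (fun x => H₂ (ux x t)) volume 0 1 := fun t ht =>
    ⟨(hH₁.continuous.comp (h.cont_ux.continuous_slice ht)).intervalIntegrable _ _,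
      (hH₂.continuous.comp (h.cont_ux.continuous_slice ht)).intervalIntegrable _ _⟩
  have hU' : ∀ t ∈ Ioo 0 T, HasDerivAt U ((A t - B t) * deriv ξ t) t := fun t ht => by
    obtain ⟨i1, i2⟩ := hint t (Ioo_subset_Icc_self ht)
    rw [hA, hB, ← integral_sub i1 i2]
    exact h.hasDerivAt_integral_u hF hHc ht
  have hAanti : AntitoneOn A (Icc 0 T) :=
    antitoneOn_of_hasDerivWithinAt_nonpos (convex_Icc 0 T) hAc (f' := A')
      (fun t ht => (hA' t (by rwa [interior_Icc] at ht)).hasDerivWithinAt)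
      (fun t ht => hA0 t (by rwa [interior_Icc] at ht))
  have hBA : ∀ t ∈ Icc 0 T, B t ≤ (1 - α) * A t := fun t ht => by
    obtain ⟨i1, i2⟩ := hint t ht
    rw [hA, hB, ← intervalIntegral.integral_const_mul]
    exact integral_mono_on zero_le_one i2 (i1.const_mul _) fun x _ => by linarith [hαH (ux x t)]
  have hξ' : ∀ t, HasDerivAt ξ (deriv ξ t) t := fun t =>
    (hξ.differentiable one_ne_zero t).hasDerivAt
  have main : ∀ ζ ζ' V : ℝ → ℝ, ContinuousOn ζ (Icc 0 T) → ContinuousOn V (Icc 0 T) →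
      (∀ t ∈ Ioo 0 T, HasDerivAt ζ (ζ' t) t) →
      (∀ t ∈ Ioo 0 T, HasDerivAt V ((A t - B t) * ζ' t) t) →
      (∀ s ∈ Icc 0 T, ∀ t ∈ Icc 0 T, V t - V s ≤ oscOn (fun x => u x 0) 0 1) →
      ζ a < ζ b → A T * (ζ b - ζ a) ≤ decayConst α * oscOn (fun x => u x 0) 0 1 := by
    intro ζ ζ' V hζ hV hζ' hV' hosc hlt
    have hsub : Icc a T ⊆ Icc 0 T := Icc_subset_Icc_left ha.1
    refine mul_sub_le_of_step hα hK (hAanti.mono hsub) (hζ.mono hsub) ?_ ⟨hab, hb.2⟩ hlt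
    intro s hs t ht hst hmin hmax
    have hI : Icc s t ⊆ Icc 0 T := Icc_subset_Icc (hsub hs).1 ht.2
    have hI' : Ioo s t ⊆ Ioo 0 T := Ioo_subset_Ioo (hsub hs).1 ht.2
    have e := sub_mul_sub_le_of_hasDerivAt hst (hV.mono hI) (hAc.mono hI) (hBc.mono hI)
      (hζ.mono hI) (fun r hr => hA' r (hI' hr)) (fun r hr => hB' r (hI' hr))
      (fun r hr => hζ' r (hI' hr)) (fun r hr => hV' r (hI' hr))
      (fun r hr => hA0 r (hI' hr)) (fun r hr => hB0 r (hI' hr)) hmin hmax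
    have e2 := hosc s (hsub hs) t (hsub ht)
    have e3 := mul_le_mul_of_nonneg_right (hBA s (hsub hs))
      (sub_nonneg.2 (hmin t (right_mem_Icc.2 hst)))
    linarith
  have hosc := fun s hs t ht =>
    abs_le.1 (h.abs_integral_sub_le_osc hF hFm hH0 (s := s) (t := t) hs ht)
  rcases lt_trichotomy (ξ a) (ξ b) with hlt | heq | hgt
  · rw [abs_of_pos (sub_pos.2 hlt)]
    exact main ξ (deriv ξ) U hξ.continuous.continuousOn hUc (fun t _ => hξ' t) hU'
      (fun s hs t ht => (hosc s hs t ht).2) hlt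
  · rw [heq, sub_self, abs_zero, mul_zero]
    exact mul_nonneg (decayConst_pos hα).le hK
  · rw [abs_of_neg (sub_neg.2 hgt)]
    have := main (fun t => -ξ t) (fun t => -deriv ξ t) (fun t => -U t)
      hξ.continuous.neg.continuousOn hUc.neg (fun t _ => (hξ' t).neg)
      (fun t ht => (hU' t ht).neg.congr_deriv (by ring))
      (fun s hs t ht => by linarith [(hosc s hs t ht).1]) (neg_lt_neg hgt)
    linarith

end IsClassicalSolution

lemma oscOn_le {ξ : ℝ → ℝ} {s t M : ℝ} (hst : s ≤ t)
    (hM : ∀ a ∈ Icc s t, ∀ b ∈ Icc s t, ξ b - ξ a ≤ M) : oscOn ξ s t ≤ M := by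
  have hne : (ξ '' Icc s t).Nonempty := (nonempty_Icc.2 hst).image ξ
  rw [oscOn, sub_le_iff_le_add]
  refine csSup_le hne ?_
  rintro _ ⟨b, hb, rfl⟩
  rw [← sub_le_iff_le_add']
  refine le_csInf hne ?_
  rintro _ ⟨a, ha, rfl⟩
  linarith [hM a ha b hb]

lemma drawup_le {ξ : ℝ → ℝ} {s t M : ℝ} (hst : s ≤ t)
    (hM : ∀ a ∈ Icc s t, ∀ b ∈ Icc s t, a ≤ b → ξ b - ξ a ≤ M) : drawup ξ s t ≤ M := by
  refine csSup_le ((nonempty_Icc.2 hst).image _) ?_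
  rintro _ ⟨b, hb, rfl⟩
  rw [sub_le_comm]
  refine le_csInf ((nonempty_Icc.2 hb.1).image ξ) ?_
  rintro _ ⟨a, ha, rfl⟩
  linarith [hM a ⟨ha.1, ha.2.trans hb.2⟩ b hb ha.2]

/-- Let `T > 0`, `ξ ∈ C¹([0,T])`, `F ∈ C¹(ℝ)` non-decreasing, and let
`H₁, H₂ ∈ C²(ℝ)` be convex with `H := H₁ - H₂` satisfying `H 0 = 0` and `H ≥ α H₁` for
some `α ∈ (0,1]`. Let `u` be a classical solution of `du = ∂ₓ(F(∂ₓu)) dt + H(∂ₓu) dξ`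
on `𝕋 × [0,T]`. Then there exists `C > 0` depending only on `α` such that
`∫_𝕋 H₁(∂ₓu(x,T)) dx ≤ C · osc(u(·,0)) / D(0,T)` provided `D(0,T) > 0`, where
`D(0,T) = max_{t ∈ [0,T]}(ξ t - min_{[0,t]} ξ)`; and if moreover `H₁` is even, then
`∫_𝕋 H₁(∂ₓu(x,T)) dx ≤ C · osc(u(·,0)) / osc_{0,T}(ξ)` provided `osc_{0,T}(ξ) > 0`. -/
theorem entropy_decay_fluctuations (α : ℝ) (hα : α ∈ Set.Ioc (0 : ℝ) 1) :
    ∃ C : ℝ, 0 < C ∧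
      ∀ (T : ℝ), 0 < T →
      ∀ ξ : ℝ → ℝ, ContDiff ℝ 1 ξ →
      ∀ F : ℝ → ℝ, ContDiff ℝ 1 F → Monotone F →
      ∀ H₁ H₂ : ℝ → ℝ, ContDiff ℝ 2 H₁ → ContDiff ℝ 2 H₂ →
        ConvexOn ℝ Set.univ H₁ → ConvexOn ℝ Set.univ H₂ →
        H₁ 0 - H₂ 0 = 0 →
        (∀ p : ℝ, α * H₁ p ≤ H₁ p - H₂ p) →
      ∀ u ux uxx ut utx : ℝ → ℝ → ℝ,
        IsClassicalSolution (Set.Icc 0 T) ξ F (fun p => H₁ p - H₂ p) u ux uxx ut utx →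
        ((0 < drawup ξ 0 T →
            ∫ x in (0 : ℝ)..1, H₁ (ux x T)
              ≤ C * oscOn (fun x => u x 0) 0 1 / drawup ξ 0 T) ∧
          ((∀ p : ℝ, H₁ (-p) = H₁ p) → 0 < oscOn ξ 0 T →
            ∫ x in (0 : ℝ)..1, H₁ (ux x T)
              ≤ C * oscOn (fun x => u x 0) 0 1 / oscOn ξ 0 T)) := by
  refine ⟨decayConst α, decayConst_pos hα, ?_⟩
  intro T hT ξ hξ F hF hFm H₁ H₂ hH₁ hH₂ hc₁ hc₂ hH0 hαH u ux uxx ut utx h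
  have h0 : (0 : ℝ) ∈ Icc 0 T := left_mem_Icc.2 hT.le
  have hK : 0 ≤ oscOn (fun x => u x 0) 0 1 :=
    (abs_nonneg _).trans (h.abs_integral_sub_le_osc hF hFm hH0 h0 h0)
  have hCK := mul_nonneg (decayConst_pos hα).le hK
  have key : ∀ a ∈ Icc 0 T, ∀ b ∈ Icc 0 T,
      (∫ x in (0 : ℝ)..1, H₁ (ux x T)) * |ξ b - ξ a|
        ≤ decayConst α * oscOn (fun x => u x 0) 0 1 := by
    intro a ha b hb
    rcases le_total a b with hab | hab
    · exact h.integral_mul_abs_sub_le hα hξ hF hFm hH₁ hH₂ hc₁ hc₂ hH0 hαH ha hb hab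
    · rw [abs_sub_comm]
      exact h.integral_mul_abs_sub_le hα hξ hF hFm hH₁ hH₂ hc₁ hc₂ hH0 hαH hb ha hab
  rcases le_or_gt (∫ x in (0 : ℝ)..1, H₁ (ux x T)) 0 with hneg | hpos
  · exact ⟨fun hD => hneg.trans (div_nonneg hCK hD.le),
      fun _ hD => hneg.trans (div_nonneg hCK hD.le)⟩
  · have key' : ∀ a ∈ Icc 0 T, ∀ b ∈ Icc 0 T, ξ b - ξ a ≤
        decayConst α * oscOn (fun x => u x 0) 0 1 / ∫ x in (0 : ℝ)..1, H₁ (ux x T) :=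
      fun a ha b hb => (le_abs_self _).trans
        ((le_div_iff₀' hpos).2 (key a ha b hb))
    refine ⟨fun hD => ?_, fun _ hD => ?_⟩
    · exact (le_div_comm₀ hD hpos).1 (drawup_le hT.le fun a ha b hb _ => key' a ha b hb)
    · exact (le_div_comm₀ hD hpos).1 (oscOn_le hT.le key')
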